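/- Let (X, ‖·‖) be a normed vector space, ρ > 0, L > 0, and n ≥ 1. Let B_L be the class of L-Lipschitz functions f : X → [−1,1], and fix a sample S = ((x_1,y_1),…,(x_n,y_n)) with x_i ∈ X and y_i ∈ [−1,1]. Define the evaluation vectors B_L ∘ S = {(f(x_1),…,f(x_n)) : f ∈ B_L} and the robust squared loss vectors ℓ_ρ ∘ B_L ∘ S = {(sup_{‖δ‖ ≤ ρ}(f(x_i + δ) − y_i)²)_{i=1}^n : f ∈ B_L}. Then Rad(ℓ_ρ ∘ B_L ∘ S) ≤ 8 · Rad(B_L ∘ S). -/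

import Mathlib

/-- Empirical Rademacher complexity of a set of vectors `A ⊆ ℝⁿ`:
the expectation, over i.i.d. uniform signs σ ∈ {−1,+1}ⁿ, of
`sup_{a ∈ A} (1/n) ∑ i, σ i * a i`. -/
noncomputable def rad {n : ℕ} (A : Set (Fin n → ℝ)) : ℝ :=
  ((2 : ℝ) ^ n)⁻¹ * ∑ σ : Fin n → Bool,
    sSup ((fun a : Fin n → ℝ =>
      (n : ℝ)⁻¹ * ∑ i, (if σ i then (1 : ℝ) else -1) * a i) '' A)

/-- The class of L-Lipschitz functions X → [−1,1]. -/
def lipClass (X : Type*) [NormedAddCommGroup X] [NormedSpace ℝ X] (L : ℝ) :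
    Set (X → ℝ) :=
  {f | (∀ x x' : X, |f x - f x'| ≤ L * ‖x - x'‖) ∧ ∀ x, f x ∈ Set.Icc (-1 : ℝ) 1}

/-- The normalized correlation of a vector with a sign pattern. -/
noncomputable def signCorr {n : ℕ} (σ : Fin n → Bool) (a : Fin n → ℝ) : ℝ :=
  (n : ℝ)⁻¹ * ∑ i, (if σ i then (1 : ℝ) else -1) * a i

lemma signCorr_add {n : ℕ} (σ : Fin n → Bool) (a b : Fin n → ℝ) :
    signCorr σ (a + b) = signCorr σ a + signCorr σ b := by
  simp [signCorr, mul_add, Finset.sum_add_distrib]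

lemma signCorr_smul {n : ℕ} (σ : Fin n → Bool) (c : ℝ) (a : Fin n → ℝ) :
    signCorr σ (c • a) = c * signCorr σ a := by
  simp only [signCorr, Pi.smul_apply, smul_eq_mul, Finset.mul_sum]
  exact Finset.sum_congr rfl fun i _ => by ring

/-- A family of vectors whose entries are uniformly bounded. -/
def UniformlyBounded {T : Type*} {n : ℕ} (v : T → Fin n → ℝ) : Prop :=
  ∃ C, ∀ t i, |v t i| ≤ C

namespace UniformlyBounded

variable {T : Type*} {n : ℕ} {v w : T → Fin n → ℝ}

lemma bddAbove (hv : UniformlyBounded v) (σ : Fin n → Bool) :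
    BddAbove (Set.range fun t => signCorr σ (v t)) := by
  obtain ⟨C, hC⟩ := hv
  refine ⟨(n : ℝ)⁻¹ * ∑ _i : Fin n, C, ?_⟩
  rintro _ ⟨t, rfl⟩
  refine mul_le_mul_of_nonneg_left (Finset.sum_le_sum fun i _ => ?_) (by positivity)
  have := abs_le.1 (hC t i)
  split_ifs <;> linarith

lemma add (hv : UniformlyBounded v) (hw : UniformlyBounded w) : UniformlyBounded (v + w) := by
  obtain ⟨C, hC⟩ := hv
  obtain ⟨D, hD⟩ := hw
  exact ⟨C + D, fun t i => (abs_add_le _ _).trans (add_le_add (hC t i) (hD t i))⟩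

lemma smul (hv : UniformlyBounded v) (c : ℝ) : UniformlyBounded (c • v) := by
  obtain ⟨C, hC⟩ := hv
  refine ⟨|c| * C, fun t i => ?_⟩
  simpa [abs_mul] using mul_le_mul_of_nonneg_left (hC t i) (abs_nonneg c)

lemma abs (hv : UniformlyBounded v) : UniformlyBounded fun t i => |v t i| := by
  obtain ⟨C, hC⟩ := hv
  exact ⟨C, fun t i => by simpa using hC t i⟩

end UniformlyBounded

lemma rad_range {T : Type*} {n : ℕ} (v : T → Fin n → ℝ) :
    rad (Set.range v) = ((2 : ℝ) ^ n)⁻¹ * ∑ σ, ⨆ t, signCorr σ (v t) := by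
  simp only [rad, ← Set.range_comp]
  rfl

lemma rad_range_smul {T : Type*} {n : ℕ} (v : T → Fin n → ℝ) {c : ℝ} (hc : 0 ≤ c) :
    rad (Set.range (c • v)) = c * rad (Set.range v) := by
  simp only [rad_range, Pi.smul_apply, signCorr_smul, ← Real.mul_iSup_of_nonneg hc,
    ← Finset.mul_sum]
  ring

lemma rad_range_add_le {T : Type*} [Nonempty T] {n : ℕ} {v w : T → Fin n → ℝ}
    (hv : UniformlyBounded v) (hw : UniformlyBounded w) :
    rad (Set.range (v + w)) ≤ rad (Set.range v) + rad (Set.range w) := by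
  simp only [rad_range, ← mul_add, ← Finset.sum_add_distrib]
  refine mul_le_mul_of_nonneg_left (Finset.sum_le_sum fun σ _ => ciSup_le fun t => ?_)
    (by positivity)
  rw [Pi.add_apply, signCorr_add]
  exact add_le_add (le_ciSup (hv.bddAbove σ) t) (le_ciSup (hw.bddAbove σ) t)

lemma rad_range_le_of_forall_exists {T : Type*} [Nonempty T] {n : ℕ} {v w : T → Fin n → ℝ}
    (hw : UniformlyBounded w) (h : ∀ t, ∃ t', v t = w t') :
    rad (Set.range v) ≤ rad (Set.range w) := by
  simp only [rad_range]
  refine mul_le_mul_of_nonneg_left (Finset.sum_le_sum fun σ _ => ciSup_le fun t => ?_)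
    (by positivity)
  obtain ⟨t', ht'⟩ := h t
  rw [ht']
  exact le_ciSup (hw.bddAbove σ) t'

/-- Flipping the sign at coordinate `i`. -/
def flipSign {n : ℕ} (i : Fin n) (σ : Fin n → Bool) : Fin n → Bool :=
  Function.update σ i (!σ i)

lemma flipSign_involutive {n : ℕ} (i : Fin n) : Function.Involutive (flipSign i) := by
  intro σ
  simp [flipSign]

lemma signCorr_eq_add_sum_erase {n : ℕ} (i : Fin n) (σ : Fin n → Bool) (a : Fin n → ℝ) :
    signCorr σ a = (n : ℝ)⁻¹ * ((if σ i then (1 : ℝ) else -1) * a i +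
      ∑ j ∈ Finset.univ.erase i, (if σ j then (1 : ℝ) else -1) * a j) := by
  rw [signCorr, Finset.add_sum_erase _ (fun j => (if σ j then (1 : ℝ) else -1) * a j)
    (Finset.mem_univ i)]

lemma signCorr_flipSign {n : ℕ} (i : Fin n) (σ : Fin n → Bool) (a : Fin n → ℝ) :
    signCorr (flipSign i σ) a = (n : ℝ)⁻¹ * (-((if σ i then (1 : ℝ) else -1) * a i) +
      ∑ j ∈ Finset.univ.erase i, (if σ j then (1 : ℝ) else -1) * a j) := by
  rw [signCorr_eq_add_sum_erase i]
  congr 2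
  · cases h : σ i <;> simp [flipSign, h]
  · refine Finset.sum_congr rfl fun j hj => ?_
    simp [flipSign, Function.update_of_ne (Finset.ne_of_mem_erase hj)]

lemma rad_range_le_of_coordinate {T : Type*} [Nonempty T] {n : ℕ} {v w : T → Fin n → ℝ}
    (hw : UniformlyBounded w) (i : Fin n) (hne : ∀ t, ∀ j ≠ i, v t j = w t j)
    (h : ∀ t t', |v t i - v t' i| ≤ |w t i - w t' i|) :
    rad (Set.range v) ≤ rad (Set.range w) := by
  simp only [rad_range]
  refine mul_le_mul_of_nonneg_left ?_ (by positivity)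
  have key : ∀ σ : Fin n → Bool,
      (⨆ t, signCorr σ (v t)) + (⨆ t, signCorr (flipSign i σ) (v t)) ≤
        (⨆ t, signCorr σ (w t)) + ⨆ t, signCorr (flipSign i σ) (w t) := by
    intro σ
    rw [← le_sub_iff_add_le]
    refine ciSup_le fun t => ?_
    rw [le_sub_comm]
    refine ciSup_le fun t' => ?_
    have h₁ := le_ciSup (hw.bddAbove σ) t
    have h₂ := le_ciSup (hw.bddAbove σ) t'
    have h₃ := le_ciSup (hw.bddAbove (flipSign i σ)) t
    have h₄ := le_ciSup (hw.bddAbove (flipSign i σ)) t'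
    simp only [signCorr_flipSign] at h₃ h₄ ⊢
    simp only [signCorr_eq_add_sum_erase i σ] at h₁ h₂ ⊢
    have hrest : ∀ t, ∑ j ∈ Finset.univ.erase i, (if σ j then (1 : ℝ) else -1) * v t j =
        ∑ j ∈ Finset.univ.erase i, (if σ j then (1 : ℝ) else -1) * w t j := fun t =>
      Finset.sum_congr rfl fun j hj => by rw [hne t j (Finset.ne_of_mem_erase hj)]
    rw [hrest, hrest]
    have hn : (0 : ℝ) ≤ (n : ℝ)⁻¹ := by positivity
    have hsign : (if σ i then (1 : ℝ) else -1) * (v t i - v t' i) ≤ |w t i - w t' i| := by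
      refine le_trans ?_ (h t t')
      have := neg_abs_le (v t i - v t' i)
      have := le_abs_self (v t i - v t' i)
      split_ifs <;> linarith
    have hscaled := mul_le_mul_of_nonneg_left hsign hn
    cases hσ : σ i <;> rcases abs_cases (w t i - w t' i) with ⟨he, -⟩ | ⟨he, -⟩ <;>
      simp only [hσ, he, if_true, Bool.false_eq_true, if_false] at * <;> linarith
  have hflip : ∀ G : (Fin n → Bool) → ℝ, ∑ σ, G (flipSign i σ) = ∑ σ, G σ := fun G =>
    Equiv.sum_comp (flipSign_involutive i).toPerm G
  have hsum := Finset.sum_le_sum fun σ (_ : σ ∈ Finset.univ) => key σ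
  rw [Finset.sum_add_distrib, Finset.sum_add_distrib,
    hflip fun σ => ⨆ t, signCorr σ (v t), hflip fun σ => ⨆ t, signCorr σ (w t)] at hsum
  linarith

/-- Talagrand's contraction principle for the empirical Rademacher complexity. -/
lemma rad_range_le_of_contraction {T : Type*} [Nonempty T] {n : ℕ} {v w : T → Fin n → ℝ}
    (hv : UniformlyBounded v) (hw : UniformlyBounded w)
    (h : ∀ t t' i, |v t i - v t' i| ≤ |w t i - w t' i|) :
    rad (Set.range v) ≤ rad (Set.range w) := by
  classical
  have hmix : ∀ s : Finset (Fin n),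
      UniformlyBounded fun t i => if i ∈ s then w t i else v t i := by
    intro s
    obtain ⟨C, hC⟩ := hv
    obtain ⟨D, hD⟩ := hw
    refine ⟨max C D, fun t i => ?_⟩
    dsimp only
    split_ifs
    exacts [(hD t i).trans (le_max_right _ _), (hC t i).trans (le_max_left _ _)]
  have key : ∀ s : Finset (Fin n),
      rad (Set.range v) ≤ rad (Set.range fun t i => if i ∈ s then w t i else v t i) := by
    intro s
    induction s using Finset.induction_on with
    | empty => simp
    | insert i s hi ih =>
      refine ih.trans (rad_range_le_of_coordinate (hmix _) i (fun t j hj => ?_) fun t t' => ?_)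
      · simp [hj]
      · simpa [hi] using h t t' i
  simpa using key Finset.univ

/-- The supremum of `f` over the closed ball of radius `ρ` around a point. -/
noncomputable def supBall {X : Type*} [NormedAddCommGroup X] (ρ : ℝ) (f : X → ℝ) (z : X) : ℝ :=
  ⨆ δ : {δ : X // ‖δ‖ ≤ ρ}, f (z + δ)

lemma supBall_le {X : Type*} [NormedAddCommGroup X] {ρ : ℝ} {f : X → ℝ} (hρ : 0 ≤ ρ)
    {z : X} {c : ℝ} (h : ∀ δ : X, ‖δ‖ ≤ ρ → f (z + δ) ≤ c) :
    supBall ρ f z ≤ c :=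
  have : Nonempty {δ : X // ‖δ‖ ≤ ρ} := ⟨⟨0, by simpa using hρ⟩⟩
  ciSup_le fun δ => h δ δ.2

section LipClass

variable {X : Type*} [NormedAddCommGroup X] [NormedSpace ℝ X] {ρ L : ℝ} {f : X → ℝ}

lemma neg_mem_lipClass (hf : f ∈ lipClass X L) : -f ∈ lipClass X L := by
  refine ⟨fun x x' => ?_, fun x => ?_⟩
  · have := hf.1 x x'
    rwa [Pi.neg_apply, Pi.neg_apply, neg_sub_neg, abs_sub_comm]
  · have := hf.2 x
    exact ⟨neg_le_neg this.2, neg_le.1 this.1⟩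

lemma le_supBall (hf : f ∈ lipClass X L) (z : X) {δ : X} (hδ : ‖δ‖ ≤ ρ) :
    f (z + δ) ≤ supBall ρ f z :=
  le_ciSup (f := fun δ : {δ : X // ‖δ‖ ≤ ρ} => f (z + δ))
    ⟨1, by rintro _ ⟨δ, rfl⟩; exact (hf.2 _).2⟩ ⟨δ, hδ⟩

lemma supBall_mem_lipClass (hρ : 0 ≤ ρ) (hf : f ∈ lipClass X L) :
    supBall ρ f ∈ lipClass X L := by
  have hle : ∀ x x' : X, supBall ρ f x - supBall ρ f x' ≤ L * ‖x - x'‖ := by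
    intro x x'
    rw [sub_le_iff_le_add]
    refine supBall_le hρ fun δ hδ => ?_
    have h₁ := (abs_le.1 (hf.1 (x + δ) (x' + δ))).2
    rw [add_sub_add_right_eq_sub] at h₁
    linarith [le_supBall hf x' hδ]
  refine ⟨fun x x' => abs_le.2 ⟨?_, hle x x'⟩, fun x => ⟨?_, supBall_le hρ fun δ _ => (hf.2 _).2⟩⟩
  · have := hle x' x
    rw [norm_sub_rev] at this
    linarith
  · exact (hf.2 _).1.trans (le_supBall hf x (δ := 0) (by simpa using hρ))

/-- The robust squared loss is the square of the largest one-sided deviation. -/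
lemma robustLoss_eq (hρ : 0 ≤ ρ) (hf : f ∈ lipClass X L) (z : X) (y : ℝ) :
    sSup ((fun δ : X => (f (z + δ) - y) ^ 2) '' {δ | ‖δ‖ ≤ ρ}) =
      max (supBall ρ f z - y) (supBall ρ (-f) z + y) ^ 2 := by
  have hub : ∀ δ : X, ‖δ‖ ≤ ρ →
      |f (z + δ) - y| ≤ max (supBall ρ f z - y) (supBall ρ (-f) z + y) := by
    intro δ hδ
    have h₁ := le_supBall hf z hδ
    have h₂ := le_supBall (neg_mem_lipClass hf) z hδ
    rw [Pi.neg_apply] at h₂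
    exact abs_le'.2 ⟨le_max_of_le_left (by linarith), le_max_of_le_right (by linarith)⟩
  have hsq : ∀ δ : X, ‖δ‖ ≤ ρ →
      (f (z + δ) - y) ^ 2 ≤ max (supBall ρ f z - y) (supBall ρ (-f) z + y) ^ 2 := fun δ hδ =>
    sq_le_sq' (abs_le.1 (hub δ hδ)).1 (abs_le.1 (hub δ hδ)).2
  have h0 : ‖(0 : X)‖ ≤ ρ := by simpa using hρ
  have hmax := (abs_nonneg _).trans (hub 0 h0)
  set S := sSup ((fun δ : X => (f (z + δ) - y) ^ 2) '' {δ | ‖δ‖ ≤ ρ}) with hS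
  have hle : ∀ δ : X, ‖δ‖ ≤ ρ → (f (z + δ) - y) ^ 2 ≤ S := fun δ hδ =>
    le_csSup ⟨_, by rintro _ ⟨δ, hδ, rfl⟩; exact hsq δ hδ⟩ ⟨δ, hδ, rfl⟩
  refine le_antisymm (csSup_le ⟨_, 0, h0, rfl⟩ ?_) ?_
  · rintro _ ⟨δ, hδ, rfl⟩
    exact hsq δ hδ
  · have hS0 : 0 ≤ S := (sq_nonneg _).trans (hle 0 h0)
    rw [← Real.le_sqrt hmax hS0]
    have habs : ∀ δ : X, ‖δ‖ ≤ ρ → |f (z + δ) - y| ≤ √S := fun δ hδ =>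
      Real.abs_le_sqrt (hle δ hδ)
    refine max_le ?_ ?_
    · rw [sub_le_iff_le_add]
      exact supBall_le hρ fun δ hδ => by linarith [(abs_le.1 (habs δ hδ)).2]
    · rw [← le_sub_iff_add_le]
      refine supBall_le hρ fun δ hδ => ?_
      rw [Pi.neg_apply]
      linarith [(abs_le.1 (habs δ hδ)).1]

end LipClass

lemma abs_sq_sub_sq_le {u u' : ℝ} (hu : |u| ≤ 2) (hu' : |u'| ≤ 2) :
    |u ^ 2 - u' ^ 2| ≤ 4 * |u - u'| := by
  rw [sq_sub_sq, abs_mul]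
  exact mul_le_mul_of_nonneg_right ((abs_add_le _ _).trans (by linarith)) (abs_nonneg _)

/-- `Rad(ℓ_ρ ∘ B_L ∘ S) ≤ 8 · Rad(B_L ∘ S)`. -/
theorem rad_robust_loss_le_eight_rad_eval
    {X : Type*} [NormedAddCommGroup X] [NormedSpace ℝ X]
    (ρ L : ℝ) (hρ : 0 < ρ) (hL : 0 < L)
    {n : ℕ} (hn : 1 ≤ n) (x : Fin n → X) (y : Fin n → ℝ)
    (hy : ∀ i, y i ∈ Set.Icc (-1 : ℝ) 1) :
    rad {v : Fin n → ℝ | ∃ f ∈ lipClass X L, v = fun i =>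
          sSup ((fun δ : X => (f (x i + δ) - y i) ^ 2) '' {δ | ‖δ‖ ≤ ρ})}
      ≤ 8 * rad {v : Fin n → ℝ | ∃ f ∈ lipClass X L, v = fun i => f (x i)} := by
  have : Nonempty (lipClass X L) := ⟨0, fun x x' => by simpa using by positivity, fun x => by simp⟩
  let e : lipClass X L → Fin n → ℝ := fun f i => f.1 (x i)
  let p : lipClass X L → Fin n → ℝ := fun f i => supBall ρ f.1 (x i)
  let q : lipClass X L → Fin n → ℝ := fun f i => supBall ρ (-f.1) (x i)
  let a : lipClass X L → Fin n → ℝ := fun f i => 2 * (p f i - y i)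
  let b : lipClass X L → Fin n → ℝ := fun f i => 2 * (q f i + y i)
  let u : lipClass X L → Fin n → ℝ := fun f i => max (p f i - y i) (q f i + y i)
  have hpL : ∀ f : lipClass X L, supBall ρ f.1 ∈ lipClass X L := fun f =>
    supBall_mem_lipClass hρ.le f.2
  have hqL : ∀ f : lipClass X L, supBall ρ (-f.1) ∈ lipClass X L := fun f =>
    supBall_mem_lipClass hρ.le (neg_mem_lipClass f.2)
  have he : UniformlyBounded e := ⟨1, fun f i => abs_le.2 (f.2.2 (x i))⟩
  have hp : UniformlyBounded p := ⟨1, fun f i => abs_le.2 ((hpL f).2 (x i))⟩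
  have hq : UniformlyBounded q := ⟨1, fun f i => abs_le.2 ((hqL f).2 (x i))⟩
  have hya : ∀ i, |y i| ≤ 1 := fun i => abs_le.2 (hy i)
  have hpe : rad (Set.range p) ≤ rad (Set.range e) :=
    rad_range_le_of_forall_exists he fun f => ⟨⟨_, hpL f⟩, rfl⟩
  have hqe : rad (Set.range q) ≤ rad (Set.range e) :=
    rad_range_le_of_forall_exists he fun f => ⟨⟨_, hqL f⟩, rfl⟩
  have ha : UniformlyBounded a :=
    (hp.add (w := fun _ i => -y i) ⟨1, fun _ i => by simpa using hya i⟩).smul 2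
  have hb : UniformlyBounded b :=
    (hq.add (w := fun _ i => y i) ⟨1, fun _ i => hya i⟩).smul 2
  have hb' := hb.smul (-1)
  have hra : rad (Set.range a) ≤ 2 * rad (Set.range p) := by
    rw [← rad_range_smul p zero_le_two]
    refine rad_range_le_of_contraction ha (hp.smul 2) fun f g i => le_of_eq (congrArg _ ?_)
    simp only [a, Pi.smul_apply, smul_eq_mul]
    ring
  have hrb : rad (Set.range b) ≤ 2 * rad (Set.range q) := by
    rw [← rad_range_smul q zero_le_two]
    refine rad_range_le_of_contraction hb (hq.smul 2) fun f g i => le_of_eq (congrArg _ ?_)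
    simp only [b, Pi.smul_apply, smul_eq_mul]
    ring
  have hrb' : rad (Set.range ((-1 : ℝ) • b)) ≤ rad (Set.range b) := by
    refine rad_range_le_of_contraction hb' hb fun f g i => le_of_eq ?_
    rw [abs_sub_comm (b f i)]
    simp only [Pi.smul_apply, smul_eq_mul]
    congr 1
    ring
  have hd := ha.add hb'
  have hrabs : rad (Set.range fun f i => |(a + (-1 : ℝ) • b) f i|) ≤
      rad (Set.range (a + (-1 : ℝ) • b)) :=
    rad_range_le_of_contraction hd.abs hd fun f g i => abs_abs_sub_abs_le _ _
  have hu : ∀ f i, |u f i| ≤ 2 := by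
    intro f i
    have h₁ := (hpL f).2 (x i)
    have h₂ := (hqL f).2 (x i)
    have h₃ := hy i
    refine abs_max_le_max_abs_abs.trans (max_le (abs_le.2 ?_) (abs_le.2 ?_)) <;>
      constructor <;> simp only [p, q] <;> linarith [h₁.1, h₁.2, h₂.1, h₂.2, h₃.1, h₃.2]
  have hsum : ∀ f i, (a + b + fun f i => |(a + (-1 : ℝ) • b) f i|) f i = 4 * u f i := by
    intro f i
    simp only [Pi.add_apply, Pi.smul_apply, smul_eq_mul, a, b, u]
    rcases le_total (p f i - y i) (q f i + y i) with h | h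
    · rw [max_eq_right h, abs_of_nonpos (by linarith)]
      ring
    · rw [max_eq_left h, abs_of_nonneg (by linarith)]
      ring
  have hru : rad (Set.range fun f i => u f i ^ 2) ≤
      rad (Set.range (a + b + fun f i => |(a + (-1 : ℝ) • b) f i|)) := by
    refine rad_range_le_of_contraction ⟨4, fun f i => ?_⟩ ((ha.add hb).add hd.abs) fun f g i => ?_
    · have := abs_le.1 (hu f i)
      rw [abs_of_nonneg (sq_nonneg _)]
      nlinarith
    · rw [hsum, hsum, ← mul_sub, abs_mul, abs_of_pos (four_pos : (0 : ℝ) < 4)]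
      exact abs_sq_sub_sq_le (hu f i) (hu g i)
  have hloss : {v : Fin n → ℝ | ∃ f ∈ lipClass X L, v = fun i =>
      sSup ((fun δ : X => (f (x i + δ) - y i) ^ 2) '' {δ | ‖δ‖ ≤ ρ})} =
      Set.range fun f i => u f i ^ 2 := by
    ext v
    constructor
    · rintro ⟨f, hf, rfl⟩
      exact ⟨⟨f, hf⟩, funext fun i => (robustLoss_eq hρ.le hf _ _).symm⟩
    · rintro ⟨f, rfl⟩
      exact ⟨f.1, f.2, funext fun i => (robustLoss_eq hρ.le f.2 _ _).symm⟩
  have heval : {v : Fin n → ℝ | ∃ f ∈ lipClass X L, v = fun i => f (x i)} = Set.range e := by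
    ext v
    constructor
    · rintro ⟨f, hf, rfl⟩
      exact ⟨⟨f, hf⟩, rfl⟩
    · rintro ⟨f, rfl⟩
      exact ⟨f.1, f.2, rfl⟩
  rw [hloss, heval]
  linarith [rad_range_add_le (ha.add hb) hd.abs, rad_range_add_le ha hb, rad_range_add_le ha hb']
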